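/- Let D be a digraph on n vertices with at most 3n − 6 edges in which every directed cycle has length at least 5, and suppose that the minimum size of a feedback arc set of D equals the maximum number of pairwise arc-disjoint directed cycles of D (as holds for planar digraphs by the Lucchesi–Younger theorem). Then D has an acyclic set of size at least 7n/15. -/

import Mathlib

/-- The edges of the cyclic sequence of vertices `l` (with wraparound):
consecutive pairs `(v₁,v₂), ..., (v_{k-1},v_k), (v_k,v₁)`. -/
def cycleEdges {V : Type*} (l : List V) : List (V × V) := l.zip (l.rotate 1)

/-- `l` is a directed cycle of the digraph with edge set `E`: a nonempty cyclic
sequence of distinct vertices all of whose consecutive edges (with wraparound)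
belong to `E`. -/
def IsDicycle {V : Type*} (E : Finset (V × V)) (l : List V) : Prop :=
  l ≠ [] ∧ l.Nodup ∧ ∀ e ∈ cycleEdges l, e ∈ E

/-- `F` is a feedback arc set: every directed cycle contains an edge of `F`. -/
def IsFAS {V : Type*} (E F : Finset (V × V)) : Prop :=
  ∀ l : List V, IsDicycle E l → ∃ e ∈ cycleEdges l, e ∈ F

/-- `A` is an acyclic set: the subdigraph induced on `A` has no directed cycle. -/
def IsAcyclicSet {V : Type*} (E : Finset (V × V)) (A : Finset V) : Prop :=
  ∀ l : List V, (∀ v ∈ l, v ∈ A) → ¬ IsDicycle E l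

/-- Edges of `F` inside `S`. -/
def edgesIn {V : Type*} [DecidableEq V] (F : Finset (V × V)) (S : Finset V) : Finset (V × V) :=
  F.filter (fun e => e.1 ∈ S ∧ e.2 ∈ S)

/-- Edges of `F` inside `S` incident with `v`. -/
def incIn {V : Type*} [DecidableEq V] (F : Finset (V × V)) (S : Finset V) (v : V) :
    Finset (V × V) :=
  (edgesIn F S).filter (fun e => e.1 = v ∨ e.2 = v)

/-- Neighbours of `v` in `S`. -/
def nbrIn {V : Type*} [DecidableEq V] (F : Finset (V × V)) (S : Finset V) (v : V) :
    Finset V :=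
  (incIn F S v).image (fun e => if e.1 = v then e.2 else e.1)

lemma card_drop {V : Type*} [DecidableEq V] (F : Finset (V × V)) (S T : Finset V)
    (hT : T ⊆ S) (I : Finset (V × V)) (hI : I ⊆ edgesIn F S)
    (hd : ∀ e ∈ I, e.1 ∉ T ∨ e.2 ∉ T) :
    (edgesIn F T).card + I.card ≤ (edgesIn F S).card := by
  rw [← Finset.card_union_of_disjoint]
  · apply Finset.card_le_card
    apply Finset.union_subset _ hI
    intro e he
    simp only [edgesIn, Finset.mem_filter] at he ⊢
    exact ⟨he.1, hT he.2.1, hT he.2.2⟩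
  · rw [Finset.disjoint_left]
    intro e he hi
    simp only [edgesIn, Finset.mem_filter] at he
    have := hd e hi
    tauto

lemma mem_nbrIn {V : Type*} [DecidableEq V] (F : Finset (V × V)) (S : Finset V) (v u : V)
    (hF : ∀ e ∈ F, e.1 ≠ e.2) :
    u ∈ nbrIn F S v ↔ u ∈ S ∧ v ∈ S ∧ u ≠ v ∧ ((v, u) ∈ F ∨ (u, v) ∈ F) := by
  simp only [nbrIn, incIn, edgesIn, Finset.mem_image, Finset.mem_filter]
  constructor
  · rintro ⟨⟨a, b⟩, ⟨⟨h1, h2, h3⟩, h4⟩, h5⟩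
    have := hF _ h1
    simp only at *
    split_ifs at h5 with h
    · subst h; subst h5; exact ⟨h3, h2, fun h => this h.symm, Or.inl h1⟩
    · have h6 : b = v := by tauto
      subst h6; subst h5; exact ⟨h2, h3, h, Or.inr h1⟩
  · rintro ⟨h1, h2, h3, h4 | h4⟩
    · exact ⟨(v, u), ⟨⟨h4, h2, h1⟩, Or.inl rfl⟩, by simp⟩
    · exact ⟨(u, v), ⟨⟨h4, h1, h2⟩, Or.inr rfl⟩, by simp [h3]⟩

lemma exists_indep {V : Type*} [DecidableEq V] (F : Finset (V × V))
    (hF : ∀ e ∈ F, e.1 ≠ e.2) (n : ℕ) : ∀ S : Finset V, S.card = n →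
    ∃ A ⊆ S, (∀ e ∈ F, ¬ (e.1 ∈ A ∧ e.2 ∈ A)) ∧
      2 * S.card ≤ 3 * A.card + (edgesIn F S).card := by
  induction n using Nat.strong_induction_on with
  | _ n ih =>
  intro S hS
  rcases S.eq_empty_or_nonempty with rfl | ⟨v0, hv0⟩
  · exact ⟨∅, by simp, by simp, by simp⟩
  by_cases h3 : ∃ v ∈ S, 3 ≤ (incIn F S v).card
  · obtain ⟨v, hv, hd⟩ := h3
    have hc := Finset.card_erase_add_one hv
    obtain ⟨A, hA, hi, hcard⟩ := ih (S.erase v).card (by omega) (S.erase v) rfl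
    refine ⟨A, hA.trans (Finset.erase_subset _ _), hi, ?_⟩
    have := card_drop F S (S.erase v) (Finset.erase_subset _ _) (incIn F S v)
      (Finset.filter_subset _ _) (by
        intro e he
        simp only [incIn, Finset.mem_filter] at he
        rcases he.2 with h | h <;> simp [h])
    omega
  push Not at h3
  -- it suffices to find a good vertex
  suffices hgood : ∃ v ∈ S, ∃ I ⊆ edgesIn F S,
      (∀ e ∈ I, e.1 ∈ insert v (nbrIn F S v) ∨ e.2 ∈ insert v (nbrIn F S v)) ∧
      2 * (nbrIn F S v).card ≤ I.card + 1 by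
    obtain ⟨v, hv, I, hI, hIe, hIc⟩ := hgood
    have hvN : v ∉ nbrIn F S v := by rw [mem_nbrIn F S v v hF]; simp
    have hsub : insert v (nbrIn F S v) ⊆ S := by
      intro u hu
      rw [Finset.mem_insert] at hu
      rcases hu with rfl | hu
      · exact hv
      · exact ((mem_nbrIn F S v u hF).1 hu).1
    have hc1 := Finset.card_insert_of_notMem hvN
    have hc2 := Finset.card_sdiff_add_card_eq_card hsub
    set T := S \ insert v (nbrIn F S v) with hTdef
    obtain ⟨A, hA, hi, hcard⟩ := ih T.card (by omega) T rfl
    have hTS : T ⊆ S := Finset.sdiff_subset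
    have hdrop := card_drop F S T hTS I hI (by
      intro e he
      rcases hIe e he with h | h
      · left; rw [hTdef, Finset.mem_sdiff]; tauto
      · right; rw [hTdef, Finset.mem_sdiff]; tauto)
    have hvA : v ∉ A := fun h => by
      have := hA h
      simp [hTdef] at this
    have key : ∀ u ∈ A, u ∈ S ∧ u ≠ v ∧ u ∉ nbrIn F S v := by
      intro u hu
      have := hA hu
      rw [hTdef, Finset.mem_sdiff, Finset.mem_insert] at this
      tauto
    refine ⟨insert v A, ?_, ?_, ?_⟩
    · exact Finset.insert_subset hv (hA.trans hTS)
    · rintro ⟨a, b⟩ he ⟨h1, h2⟩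
      have hne := hF _ he
      simp only [Finset.mem_insert] at h1 h2 hne
      rcases h1 with rfl | h1 <;> rcases h2 with rfl | h2
      · exact hne rfl
      · have := key b h2
        rw [mem_nbrIn F S _ _ hF] at this
        tauto
      · have := key a h1
        rw [mem_nbrIn F S _ _ hF] at this
        tauto
      · exact hi _ he ⟨h1, h2⟩
    · rw [Finset.card_insert_of_notMem hvA]
      omega
  have hle : ∀ v, (nbrIn F S v).card ≤ (incIn F S v).card := fun v => Finset.card_image_le
  have hinc : ∀ v, ∀ e ∈ incIn F S v, e.1 = v ∨ e.2 = v := fun v e he =>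
    (Finset.mem_filter.1 he).2
  by_cases h1 : ∃ v ∈ S, (nbrIn F S v).card ≤ 1
  · obtain ⟨v, hv, h⟩ := h1
    refine ⟨v, hv, incIn F S v, Finset.filter_subset _ _, ?_, ?_⟩
    · intro e he
      rcases hinc v e he with h | h <;> simp [h]
    · have := hle v
      omega
  push Not at h1
  have hv2 := h1 v0 hv0
  have hv3 := h3 v0 hv0
  have hv4 := hle v0
  obtain ⟨a, ha, b, hb, hab⟩ := Finset.one_lt_card.1 hv2
  have ha' := (mem_nbrIn F S v0 a hF).1 ha
  have hb' := (mem_nbrIn F S v0 b hF).1 hb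
  refine ⟨v0, hv0, incIn F S v0 ∪ incIn F S a,
    Finset.union_subset (Finset.filter_subset _ _) (Finset.filter_subset _ _), ?_, ?_⟩
  · intro e he
    rcases Finset.mem_union.1 he with he | he
    · rcases hinc _ e he with h | h <;> simp [h]
    · rcases hinc _ e he with h | h <;> simp [h, ha]
  · have ha2 := h1 a ha'.1
    have ha4 := hle a
    -- an edge between v0 and b is not incident with a
    obtain ⟨f, hf, hfa⟩ : ∃ f ∈ incIn F S v0, f ∉ incIn F S a := by
      rcases hb'.2.2.2 with h | h
      · refine ⟨(v0, b), ?_, ?_⟩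
        · simp [incIn, edgesIn, h, hv0, hb'.1]
        · intro h'
          rcases hinc _ _ h' with h' | h'
          · exact ha'.2.2.1 h'.symm
          · exact hab h'.symm
      · refine ⟨(b, v0), ?_, ?_⟩
        · simp [incIn, edgesIn, h, hv0, hb'.1]
        · intro h'
          rcases hinc _ _ h' with h' | h'
          · exact hab h'.symm
          · exact ha'.2.2.1 h'.symm
    have hsub : insert f (incIn F S a) ⊆ incIn F S v0 ∪ incIn F S a :=
      Finset.insert_subset (Finset.mem_union_left _ hf) Finset.subset_union_right
    have hcc := Finset.card_le_card hsub
    rw [Finset.card_insert_of_notMem hfa] at hcc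
    omega

lemma cycleEdges_length {V : Type*} (l : List V) : (cycleEdges l).length = l.length := by
  simp [cycleEdges]

lemma cycleEdges_nodup {V : Type*} (l : List V) (h : l.Nodup) : (cycleEdges l).Nodup := by
  apply List.Nodup.of_map Prod.fst
  rw [cycleEdges, List.map_fst_zip (by simp)]
  exact h

lemma packing_bound {V : Type*} [DecidableEq V] (E : Finset (V × V))
    (hgirth : ∀ l : List V, IsDicycle E l → 5 ≤ l.length) (H : Finset (List V))
    (hH : ∀ l ∈ H, IsDicycle E l)
    (hp : (H : Set (List V)).Pairwise (fun l l' => ∀ e ∈ cycleEdges l, e ∉ cycleEdges l')) :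
    5 * H.card ≤ E.card := by
  have h1 : (H.biUnion (fun l => (cycleEdges l).toFinset)).card
      = ∑ l ∈ H, ((cycleEdges l).toFinset).card := by
    apply Finset.card_biUnion
    intro l hl l' hl' hne
    refine Finset.disjoint_left.2 ?_
    intro e he he'
    exact hp hl hl' hne e (List.mem_toFinset.1 he) (List.mem_toFinset.1 he')
  have h2 : H.biUnion (fun l => (cycleEdges l).toFinset) ⊆ E := by
    intro e he
    obtain ⟨l, hl, he⟩ := Finset.mem_biUnion.1 he
    exact (hH l hl).2.2 e (List.mem_toFinset.1 he)
  have h3 : H.card • 5 ≤ ∑ l ∈ H, ((cycleEdges l).toFinset).card := by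
    apply Finset.card_nsmul_le_sum
    intro l hl
    rw [List.toFinset_card_of_nodup (cycleEdges_nodup l (hH l hl).2.1), cycleEdges_length]
    exact hgirth l (hH l hl)
  have h4 := Finset.card_le_card h2
  rw [smul_eq_mul] at h3
  omega

/-- A digraph on `n` vertices with at most `3n - 6` edges, in which every
directed cycle has length at least `5`, and which has the Lucchesi–Younger
property (min feedback arc set = max arc-disjoint cycle packing), has an
acyclic set of size at least `7n/15`. -/
theorem acyclic_set_of_digirth_five {V : Type*} [Fintype V] [DecidableEq V]
    (E : Finset (V × V)) (hE : ∀ e ∈ E, e.1 ≠ e.2)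
    (hm : (E.card : ℤ) ≤ 3 * (Fintype.card V : ℤ) - 6)
    (hgirth : ∀ l : List V, IsDicycle E l → 5 ≤ l.length)
    (hLY : sInf {k : ℕ | ∃ F : Finset (V × V), F ⊆ E ∧ IsFAS E F ∧ F.card = k} =
           sSup {k : ℕ | ∃ H : Finset (List V), (∀ l ∈ H, IsDicycle E l) ∧
             (H : Set (List V)).Pairwise
               (fun l l' => ∀ e ∈ cycleEdges l, e ∉ cycleEdges l') ∧
             H.card = k}) :
    ∃ A : Finset V, IsAcyclicSet E A ∧
      7 * (Fintype.card V : ℝ) / 15 ≤ (A.card : ℝ) := by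
  have hmem : sInf {k : ℕ | ∃ F : Finset (V × V), F ⊆ E ∧ IsFAS E F ∧ F.card = k} ∈
      {k : ℕ | ∃ F : Finset (V × V), F ⊆ E ∧ IsFAS E F ∧ F.card = k} := by
    apply Nat.sInf_mem
    refine ⟨E.card, E, Finset.Subset.refl _, ?_, rfl⟩
    intro l hl
    have hne : cycleEdges l ≠ [] := by
      intro h
      have h' := cycleEdges_length l
      rw [h] at h'
      exact hl.1 (List.length_eq_zero_iff.1 h'.symm)
    obtain ⟨e, he⟩ := List.exists_mem_of_ne_nil _ hne
    exact ⟨e, he, hl.2.2 e he⟩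
  obtain ⟨F, hFE, hFAS, hFc⟩ := hmem
  have hle : F.card ≤ E.card / 5 := by
    rw [hFc, hLY]
    apply csSup_le
    · exact ⟨0, ∅, by simp, by simp, by simp⟩
    · rintro k ⟨H, hH, hp, rfl⟩
      have := packing_bound E hgirth H hH hp
      omega
  obtain ⟨A, -, hi, hc⟩ := exists_indep F (fun e he => hE e (hFE he)) _ Finset.univ rfl
  refine ⟨A, ?_, ?_⟩
  · intro l hl hcyc
    obtain ⟨⟨a, b⟩, he, heF⟩ := hFAS l hcyc
    have h := List.of_mem_zip he
    rw [List.mem_rotate] at h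
    exact hi _ heF ⟨hl _ h.1, hl _ h.2⟩
  · have h1 : (edgesIn F Finset.univ).card ≤ F.card := Finset.card_filter_le _ _
    rw [Finset.card_univ] at hc
    have h2 : 7 * Fintype.card V ≤ 15 * A.card := by omega
    have h3 : (7 * Fintype.card V : ℝ) ≤ 15 * A.card := by exact_mod_cast h2
    linarith
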